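/- Let n be a positive integer, write points of ℝ^{2n+1} as (x, y, z) with x, y ∈ ℝⁿ and z ∈ ℝ, and let α be the standard contact form and β = dα its (constant) exterior derivative. Let X : ℝ^{2n+1} → ℝ^{2n+1} be a smooth vector field and f : ℝ^{2n+1} → ℝ a smooth function such that for every p ∈ ℝ^{2n+1} and every v ∈ ℝ^{2n+1}, β(X(p), v) + D g(p)(v) = f(p)·α_p(v), where g : ℝ^{2n+1} → ℝ is the function g(p) = α_p(X(p)) and D g denotes its Fréchet derivative (i.e. the Lie derivative of α along X equals f·α, so X is a contact vector field). Suppose φ : ℝ × ℝ^{2n+1} → ℝ^{2n+1} is a smooth map with φ(0, p) = p and ∂φ/∂t (t, p) = X(φ(t, p)) for all t, p (a global flow of X). Then for all t ∈ ℝ, p ∈ ℝ^{2n+1} and v ∈ ℝ^{2n+1}: α_{φ(t,p)}( D_p φ(t, ·)(v) ) = exp( ∫₀ᵗ f(φ(s, p)) ds ) · α_p(v), i.e. φ_t^* α = λ_t α with λ_t = e^{∫₀ᵗ f∘φ_s ds}; in particular the flow of a contact vector field preserves the contact structure ker α. -/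

import Mathlib

/-- `ℝ^{2n+1}`, written as `(x, y, z)` with `x, y ∈ ℝⁿ` and `z ∈ ℝ`. -/
abbrev EucOdd (n : ℕ) : Type := (Fin n → ℝ) × (Fin n → ℝ) × ℝ

/-- The standard contact form `α = dz + Σᵢ xᵢ dyᵢ` on `ℝ^{2n+1}`, as a continuous-linear-
functional-valued map: `(stdContactForm n p) (u, v, w) = w + Σᵢ pₓᵢ vᵢ`. -/
noncomputable def stdContactForm (n : ℕ) (p : EucOdd n) : EucOdd n →L[ℝ] ℝ :=
  (ContinuousLinearMap.snd ℝ (Fin n → ℝ) ℝ).comp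
      (ContinuousLinearMap.snd ℝ (Fin n → ℝ) ((Fin n → ℝ) × ℝ)) +
    ∑ i : Fin n, p.1 i •
      ((ContinuousLinearMap.proj i : (Fin n → ℝ) →L[ℝ] ℝ).comp
        ((ContinuousLinearMap.fst ℝ (Fin n → ℝ) ℝ).comp
          (ContinuousLinearMap.snd ℝ (Fin n → ℝ) ((Fin n → ℝ) × ℝ))))

/-- The constant 2-form `β = dα`: `β((u,v,w),(u',v',w')) = Σᵢ (uᵢ v'ᵢ − vᵢ u'ᵢ)`. -/
def stdDContactForm (n : ℕ) (a b : EucOdd n) : ℝ :=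
  ∑ i : Fin n, (a.1 i * b.2.1 i - a.2.1 i * b.1 i)

theorem stdContactForm_apply (n : ℕ) (p v : EucOdd n) :
    stdContactForm n p v = v.2.2 + ∑ i : Fin n, p.1 i * v.2.1 i := by
  simp [stdContactForm]

/-- Leibniz rule for the contact form evaluated on a vector field along a curve. -/
theorem hasDerivAt_stdContactForm {n : ℕ} {c w : ℝ → EucOdd n} {c' w' : EucOdd n} {s : ℝ}
    (hc : HasDerivAt c c' s) (hw : HasDerivAt w w' s) :
    HasDerivAt (fun r => stdContactForm n (c r) (w r))
      (stdContactForm n (c s) w' + ∑ i : Fin n, c'.1 i * (w s).2.1 i) s := by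
  simp only [stdContactForm_apply]
  have hx : ∀ i, HasDerivAt (fun r => (c r).1 i) (c'.1 i) s := hasDerivAt_pi.1 hc.fst
  have hy : ∀ i, HasDerivAt (fun r => (w r).2.1 i) (w'.2.1 i) s := hasDerivAt_pi.1 hw.snd.fst
  have hz : HasDerivAt (fun r => (w r).2.2) w'.2.2 s := hw.snd.snd
  refine (hz.fun_add
    (HasDerivAt.fun_sum fun i (_ : i ∈ Finset.univ) => (hx i).fun_mul (hy i))).congr_deriv ?_
  rw [Finset.sum_add_distrib]
  ring

/-- The derivative of `q ↦ α_q(X(q))`. -/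
theorem fderiv_stdContactForm_apply {n : ℕ} {X : EucOdd n → EucOdd n} {p : EucOdd n}
    (hX : DifferentiableAt ℝ X p) (v : EucOdd n) :
    fderiv ℝ (fun q => stdContactForm n q (X q)) p v =
      stdContactForm n p (fderiv ℝ X p v) + ∑ i : Fin n, v.1 i * (X p).2.1 i := by
  have hg : DifferentiableAt ℝ (fun q => stdContactForm n q (X q)) p := by
    simp only [stdContactForm_apply]
    fun_prop
  have hline : HasDerivAt (fun r : ℝ => p + r • v) v 0 := by
    simpa using ((hasDerivAt_id (0 : ℝ)).smul_const v).const_add p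
  have hp : p = p + (0 : ℝ) • v := by simp
  have hXline : HasDerivAt (fun r : ℝ => X (p + r • v)) (fderiv ℝ X p v) 0 :=
    hX.hasFDerivAt.comp_hasDerivAt_of_eq 0 hline hp
  have hgline := hg.hasFDerivAt.comp_hasDerivAt_of_eq 0 hline hp
  simpa using hgline.unique (hasDerivAt_stdContactForm hline hXline)

/-- The variational equation: the space derivative `V` of a flow of `X` satisfies
`V' = DX(φ) V`. -/
theorem hasDerivAt_fderiv_flow {E : Type*} [NormedAddCommGroup E] [NormedSpace ℝ E]
    {X : E → E} (hX : Differentiable ℝ X) {φ : ℝ × E → E} (hφ : ContDiff ℝ 2 φ)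
    (hflow : ∀ (t : ℝ) (p : E), HasDerivAt (fun s => φ (s, p)) (X (φ (t, p))) t)
    (t : ℝ) (p v : E) :
    HasDerivAt (fun s => fderiv ℝ (fun q => φ (s, q)) p v)
      (fderiv ℝ X (φ (t, p)) (fderiv ℝ (fun q => φ (t, q)) p v)) t := by
  have hd : Differentiable ℝ φ := hφ.differentiable (by norm_num)
  have hd2 : Differentiable ℝ (fderiv ℝ φ) :=
    (hφ.fderiv_right (m := 1) (by norm_num)).differentiable (by norm_num)
  have hspace : ∀ s, fderiv ℝ (fun q => φ (s, q)) p v = fderiv ℝ φ (s, p) (0, v) := fun s => by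
    have h : HasFDerivAt (fun q => φ (s, q)) _ p :=
      (hd (s, p)).hasFDerivAt.comp p (hasFDerivAt_prodMk_right s p)
    simp [h.fderiv]
  have hcurve : ∀ s q, HasDerivAt (fun r : ℝ => (r, q)) ((1 : ℝ), (0 : E)) s := fun s q =>
    (hasDerivAt_id s).prodMk (hasDerivAt_const s q)
  have htime : (fun z => fderiv ℝ φ z (1, 0)) = fun z => X (φ z) := by
    funext z
    exact ((hd z).hasFDerivAt.comp_hasDerivAt z.1 (hcurve z.1 z.2)).unique (hflow z.1 z.2)
  have hsymm : fderiv ℝ (fderiv ℝ φ) (t, p) (1, 0) (0, v) =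
      fderiv ℝ (fderiv ℝ φ) (t, p) (0, v) (1, 0) :=
    (hφ.contDiffAt.isSymmSndFDerivAt (by simp)).eq _ _
  have hmixed : fderiv ℝ (fderiv ℝ φ) (t, p) (0, v) (1, 0) =
      fderiv ℝ X (φ (t, p)) (fderiv ℝ φ (t, p) (0, v)) := by
    have h₁ := (hd2 (t, p)).hasFDerivAt.clm_apply (hasFDerivAt_const ((1 : ℝ), (0 : E)) (t, p))
    have h₂ := (hX (φ (t, p))).hasFDerivAt.comp (t, p) (hd (t, p)).hasFDerivAt
    rw [htime] at h₁
    simpa using DFunLike.congr_fun (h₁.unique h₂) (0, v)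
  have hD : HasDerivAt (fun s => fderiv ℝ φ (s, p)) (fderiv ℝ (fderiv ℝ φ) (t, p) (1, 0)) t :=
    (hd2 (t, p)).hasFDerivAt.comp_hasDerivAt t (hcurve t p)
  have hev := (ContinuousLinearMap.apply ℝ E ((0 : ℝ), v)).hasFDerivAt.comp_hasDerivAt t hD
  simp only [hspace]
  rw [← hmixed, ← hsymm]
  exact hev

/-- Solutions of the scalar linear equation `A' = a A` are `A(t) = e^{∫₀ᵗ a} A(0)`. -/
theorem eq_exp_integral_mul_of_hasDerivAt {a A : ℝ → ℝ} (ha : Continuous a)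
    (hA : ∀ s, HasDerivAt A (a s * A s) s) (t : ℝ) :
    A t = Real.exp (∫ s in (0 : ℝ)..t, a s) * A 0 := by
  have hI : ∀ s, HasDerivAt (fun r => ∫ u in (0 : ℝ)..r, a u) (a s) s := fun s =>
    ha.integral_hasStrictDerivAt 0 s |>.hasDerivAt
  have hB : ∀ s, HasDerivAt (fun r => Real.exp (-∫ u in (0 : ℝ)..r, a u) * A r) 0 s := fun s =>
    ((hI s).fun_neg.exp.fun_mul (hA s)).congr_deriv (by ring)
  have hconst := is_const_of_deriv_eq_zero (fun s => (hB s).differentiableAt)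
    (fun s => (hB s).deriv) t 0
  simp only [intervalIntegral.integral_same, neg_zero, Real.exp_zero, one_mul] at hconst
  rw [← hconst, ← mul_assoc, ← Real.exp_add, add_neg_cancel, Real.exp_zero, one_mul]

/-- The flow of a contact vector field on `(ℝ^{2n+1}, α_std)` rescales the
contact form: if `L_X α = f·α` (i.e. `β(X(p), ·) + D(α(X))(p) = f(p)·α_p`) and `φ` is a
global flow of `X`, then `φₜ* α = e^{∫₀ᵗ f∘φ_s ds} · α`. -/
theorem contact_flow_preserves_contact_structure
    (n : ℕ) (hn : 0 < n)
    (X : EucOdd n → EucOdd n) (hX : ContDiff ℝ (⊤ : ℕ∞) X)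
    (f : EucOdd n → ℝ) (hf : ContDiff ℝ (⊤ : ℕ∞) f)
    (hLie : ∀ p v : EucOdd n,
      stdDContactForm n (X p) v +
        fderiv ℝ (fun q => stdContactForm n q (X q)) p v = f p * stdContactForm n p v)
    (φ : ℝ × EucOdd n → EucOdd n) (hφ : ContDiff ℝ (⊤ : ℕ∞) φ)
    (hφ0 : ∀ p : EucOdd n, φ (0, p) = p)
    (hflow : ∀ (t : ℝ) (p : EucOdd n), HasDerivAt (fun s => φ (s, p)) (X (φ (t, p))) t) :
    ∀ (t : ℝ) (p v : EucOdd n),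
      stdContactForm n (φ (t, p)) (fderiv ℝ (fun q => φ (t, q)) p v) =
        Real.exp (∫ s in (0:ℝ)..t, f (φ (s, p))) * stdContactForm n p v := by
  intro t p v
  have hXd : Differentiable ℝ X := hX.differentiable (by simp)
  have hφ2 : ContDiff ℝ 2 φ := contDiff_infty.1 hφ 2
  have ha : Continuous fun s => f (φ (s, p)) :=
    hf.continuous.comp (hφ.continuous.comp (by fun_prop))
  have hA : ∀ s, HasDerivAt
      (fun r => stdContactForm n (φ (r, p)) (fderiv ℝ (fun q => φ (r, q)) p v))
      (f (φ (s, p)) * stdContactForm n (φ (s, p)) (fderiv ℝ (fun q => φ (s, q)) p v)) s := by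
    intro s
    refine (hasDerivAt_stdContactForm (hflow s p)
      (hasDerivAt_fderiv_flow hXd hφ2 hflow s p v)).congr_deriv ?_
    rw [← hLie, fderiv_stdContactForm_apply (hXd _), stdDContactForm, Finset.sum_sub_distrib]
    simp only [mul_comm (Prod.fst (fderiv ℝ (fun q => φ (s, q)) p v) _)]
    ring
  have h := eq_exp_integral_mul_of_hasDerivAt ha hA t
  simpa [hφ0] using h
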